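/- Let K be a commutative Noetherian normal domain, n ≥ 2, X the generic n×n matrix over K with entries in S = K[x_{ij}], R = S/(det X), and L the cokernel of the R-linear map Rⁿ → Rⁿ given by the matrix X̄ (X reduced mod det X). Then Ext²_R(L, L) is isomorphic, as an R-module, to S/I_{n−1}(X), where I_{n−1}(X) ⊆ S is the ideal generated by the (n−1)×(n−1) minors of X (note det X ∈ I_{n−1}(X), so S/I_{n−1}(X) is naturally an R-module). -/

import Mathlib

open Matrix CategoryTheory

noncomputable section

/-- The generic `n × n` matrix, whose `(i,j)` entry is the indeterminate `x_{ij}` of the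
polynomial ring `S = K[x_{ij}]`. -/
def genericMatrix (K : Type*) [CommRing K] (n : ℕ) :
    Matrix (Fin n) (Fin n) (MvPolynomial (Fin n × Fin n) K) :=
  Matrix.of fun i j => MvPolynomial.X (i, j)

/-- The generic determinantal hypersurface ring `R = S/(det X)`. -/
abbrev genericDetRing (K : Type*) [CommRing K] (n : ℕ) :=
  MvPolynomial (Fin n × Fin n) K ⧸ Ideal.span {(genericMatrix K n).det}

/-- The generic matrix reduced modulo its determinant. -/
def genericMatrixBar (K : Type*) [CommRing K] (n : ℕ) :
    Matrix (Fin n) (Fin n) (genericDetRing K n) :=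
  (genericMatrix K n).map (Ideal.Quotient.mk _)

/-- The ideal `I_{n-1}(X) ⊆ S` generated by the `(n-1) × (n-1)` minors of the generic matrix. -/
def minorsIdeal (K : Type*) [CommRing K] (n : ℕ) :
    Ideal (MvPolynomial (Fin n × Fin n) K) :=
  Ideal.span { d | ∃ f g : Fin (n - 1) → Fin n, StrictMono f ∧ StrictMono g ∧
    d = ((genericMatrix K n).submatrix f g).det }

theorem Finsupp.le_of_le_add_of_disjoint {σ : Type*} {a b c : σ →₀ ℕ}
    (hbc : ∀ p, b p = 0 ∨ c p = 0) (h : b ≤ a + c) : b ≤ a := by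
  intro p
  have := h p
  rcases hbc p with h0 | h0 <;> simp_all

namespace MonomialOrder

variable {σ R : Type*} [CommRing R] {m : MonomialOrder σ} {f g h : MvPolynomial σ R}

theorem Monic.degree_mul_of_ne_zero (hf : m.Monic f) (hg : g ≠ 0) :
    m.degree (g * f) = m.degree g + m.degree f :=
  m.degree_mul_of_isRegular_right hg (by rw [hf.leadingCoeff_eq_one]; exact isRegular_one)

theorem Monic.isUnit_leadingCoeff (hf : m.Monic f) : IsUnit (m.leadingCoeff f) := by
  rw [hf.leadingCoeff_eq_one]; exact isUnit_one

theorem Monic.isRegular (hf : m.Monic f) : IsRegular f := by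
  rw [isRegular_iff_mem_nonZeroDivisors]
  apply m.mem_nonZeroDivisors_of_leadingCoeff_mem_nonZeroDivisors
  rw [hf.leadingCoeff_eq_one]
  exact one_mem _

/-- Monic polynomials with coprime leading monomials form a regular sequence. -/
theorem Monic.dvd_of_dvd_mul (hg : m.Monic g) (hh : m.Monic h)
    (hgh : ∀ p, m.degree g p = 0 ∨ m.degree h p = 0) (H : g ∣ f * h) : g ∣ f := by
  obtain ⟨q, r, rfl, -, hr⟩ := m.div_single hg.isUnit_leadingCoeff f
  obtain ⟨b, hb⟩ := H
  by_cases hr0 : r = 0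
  · simp [hr0]
  have key : r * h = (b - q * h) * g := by linear_combination hb
  have h1 := hh.degree_mul_of_ne_zero hr0
  have hne : b - q * h ≠ 0 := by
    intro h0
    rw [h0, zero_mul] at key
    exact hr0 (hh.isRegular.right (by simpa using key))
  rw [key, hg.degree_mul_of_ne_zero hne] at h1
  exact absurd (Finsupp.le_of_le_add_of_disjoint hgh (h1 ▸ le_add_self))
    (hr _ (m.degree_mem_support hr0))

/-- Two monic polynomials with coprime leading monomials form a Gröbner basis. -/
theorem Monic.degree_le_of_mem_span_pair (hg : m.Monic g) (hh : m.Monic h)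
    (hgh : ∀ p, m.degree g p = 0 ∨ m.degree h p = 0) (hf : f ∈ Ideal.span {g, h}) (hf0 : f ≠ 0) :
    m.degree g ≤ m.degree f ∨ m.degree h ≤ m.degree f := by
  obtain ⟨x, y, rfl⟩ := Ideal.mem_span_pair.1 hf
  obtain ⟨q, r, rfl, -, hr⟩ := m.div_single hh.isUnit_leadingCoeff x
  have key : (q * h + r) * g + y * h = r * g + (q * g + y) * h := by ring
  rw [key] at hf0 ⊢
  set z := q * g + y
  by_cases hr0 : r = 0
  · right
    have hz : z ≠ 0 := by rintro h0; simp [h0, hr0] at hf0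
    rw [hr0, zero_mul, zero_add, hh.degree_mul_of_ne_zero hz]
    exact le_add_self
  by_cases hz : z = 0
  · left
    rw [hz, zero_mul, add_zero, hg.degree_mul_of_ne_zero hr0]
    exact le_add_self
  have h1 := hg.degree_mul_of_ne_zero hr0
  have h2 := hh.degree_mul_of_ne_zero hz
  have hne : m.degree (r * g) ≠ m.degree (z * h) := by
    intro he
    refine hr _ (m.degree_mem_support hr0)
      (Finsupp.le_of_le_add_of_disjoint (c := m.degree g) (fun p => (hgh p).symm) ?_)
    rw [← h1, he, h2]
    exact le_add_self
  rcases lt_or_gt_of_ne (m.toSyn.injective.ne hne) with hlt | hlt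
  · right
    rw [m.degree_add_eq_right_of_lt hlt, h2]
    exact le_add_self
  · left
    rw [m.degree_add_of_lt hlt, h1]
    exact le_add_self

/-- Three monic polynomials with pairwise coprime leading monomials form a regular sequence. -/
theorem Monic.mem_span_pair_of_mul_mem {d : MvPolynomial σ R} (hg : m.Monic g) (hh : m.Monic h)
    (hd : m.Monic d) (hgh : ∀ p, m.degree g p = 0 ∨ m.degree h p = 0)
    (hgd : ∀ p, m.degree g p = 0 ∨ m.degree d p = 0)
    (hhd : ∀ p, m.degree h p = 0 ∨ m.degree d p = 0) (H : f * d ∈ Ideal.span {g, h}) :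
    f ∈ Ideal.span {g, h} := by
  obtain ⟨q, r, hf, -, hr⟩ := m.div (b := ![g, h])
    (by simp [Fin.forall_fin_two, hg.isUnit_leadingCoeff, hh.isUnit_leadingCoeff]) f
  have hq : f - r ∈ Ideal.span {g, h} := by
    rw [hf, add_sub_cancel_right, Ideal.mem_span_pair]
    exact ⟨q 0, q 1, by simp [Finsupp.linearCombination_apply, Finsupp.sum_fintype]⟩
  by_cases hr0 : r = 0
  · simpa [hr0] using hq
  exfalso
  have hrd : r * d ∈ Ideal.span {g, h} := by
    have := sub_mem H (Ideal.mul_mem_right d _ hq)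
    rwa [sub_mul, sub_sub_cancel] at this
  have hrd0 : r * d ≠ 0 := fun h0 => hr0 (hd.isRegular.right (by simpa using h0))
  have hmem := m.degree_mem_support hr0
  have := hg.degree_le_of_mem_span_pair hh hgh hrd hrd0
  rw [hd.degree_mul_of_ne_zero hr0] at this
  rcases this with h1 | h1
  · exact hr _ hmem 0 (Finsupp.le_of_le_add_of_disjoint hgd h1)
  · exact hr _ hmem 1 (Finsupp.le_of_le_add_of_disjoint hhd h1)

end MonomialOrder

namespace Matrix

variable {ι D : Type*} [Fintype ι] [DecidableEq ι] [CommRing D]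

/-- A form of Cramer's rule: modulo the column space of `X`, the matrix `E_{ab} * adj X` acts as
the scalar `(adj X)_{ba}`. -/
theorem exists_adjugate_smul_single_sub_eq_mulVec (X : Matrix ι ι D) (a b j : ι) :
    ∃ w : ι → D, X.adjugate b j • Pi.single a 1 - X.adjugate b a • Pi.single j 1 = X *ᵥ w := by
  set X' := X.updateCol b (Pi.single j 1) with hX'
  set w := cramer X' (Pi.single a 1) with hw
  have hdet : X'.det = X.adjugate b j := by
    rw [← cramer_apply, cramer_eq_adjugate_mulVec]; simp
  have hwb : w b = X.adjugate b a := by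
    rw [hw, cramer_apply, hX', updateCol_idem, ← cramer_apply, cramer_eq_adjugate_mulVec]; simp
  have key : X' *ᵥ w = X.adjugate b j • Pi.single a 1 := by rw [hw, mulVec_cramer, hdet]
  refine ⟨Function.update w b 0, ?_⟩
  rw [← key, sub_eq_iff_eq_add]
  ext i
  simp only [mulVec, dotProduct, Pi.add_apply, Pi.smul_apply, smul_eq_mul, ← hwb]
  rw [← Finset.add_sum_erase _ _ (Finset.mem_univ b),
    ← Finset.add_sum_erase (a := b) _ _ (Finset.mem_univ b)]
  have : ∑ x ∈ Finset.univ.erase b, X' i x * w x =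
      ∑ x ∈ Finset.univ.erase b, X i x * Function.update w b 0 x := by
    refine Finset.sum_congr rfl fun x hx => ?_
    have hxb := Finset.ne_of_mem_erase hx
    simp [hX', updateCol_ne, hxb]
  rw [this]
  simp [hX']
  ring

/-- Modulo the column space of `X`, the matrix `A * adj X` acts as the scalar `tr (A * adj X)`. -/
theorem exists_mul_adjugate_eq (X A : Matrix ι ι D) :
    ∃ M, A * X.adjugate = trace (A * X.adjugate) • (1 : Matrix ι ι D) + X * M := by
  induction A using Matrix.induction_on' with
  | h_zero => exact ⟨0, by simp⟩
  | h_add A B hA hB =>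
    obtain ⟨M, hM⟩ := hA
    obtain ⟨N, hN⟩ := hB
    refine ⟨M + N, ?_⟩
    rw [add_mul, trace_add, add_smul, mul_add]
    nth_rw 1 [hM, hN]
    abel
  | h_std_basis a b x =>
    choose w hw using X.exists_adjugate_smul_single_sub_eq_mulVec a b
    refine ⟨x • (Matrix.of w)ᵀ, ?_⟩
    have htr : trace (Matrix.single a b x * X.adjugate) = x * X.adjugate b a := by
      simp [trace_single_mul]
    rw [htr, ← sub_eq_iff_eq_add']
    ext i j
    have := congrFun (hw j) i
    have h2 : (X * (x • (Matrix.of w)ᵀ)) i j = x * (X *ᵥ w j) i := by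
      simp [mul_apply, mulVec, dotProduct, Finset.mul_sum, mul_left_comm]
    rw [h2, ← this]
    by_cases hia : i = a <;> by_cases hij : i = j <;>
      simp [hia, hij, Pi.single_apply, one_apply, mul_sub, single_mul_apply_of_ne]
    subst hij
    simp [hia, single_mul_apply_of_ne]

/-- The endomorphisms of the cokernel of `X` are scalars, provided that `det X` and two linear
combinations of the entries of `adj X` form a regular sequence. -/
theorem exists_eq_smul_one_add_mul {X A B E₁ E₂ : Matrix ι ι D} (hAB : A * X = X * B)
    {g h : D} (hg : trace (E₁ * X.adjugate) = g) (hh : trace (E₂ * X.adjugate) = h)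
    (hg_reg : IsRegular g)
    (hdg : ∀ x, X.det ∣ x * g → X.det ∣ x) (hgd : ∀ x, g ∣ x * X.det → g ∣ x)
    (hgh : ∀ x, g ∣ x * h → g ∣ x)
    (hghd : ∀ x, x * X.det ∈ Ideal.span {g, h} → x ∈ Ideal.span {g, h}) :
    ∃ (c : D) (M : Matrix ι ι D), A = c • 1 + X * M := by
  have scal : ∀ E : Matrix ι ι D, ∃ (c : D) (N : Matrix ι ι D),
      trace (E * X.adjugate) • A = c • 1 + X * N := by
    intro E
    obtain ⟨M, hM⟩ := X.exists_mul_adjugate_eq E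
    obtain ⟨M', hM'⟩ := X.exists_mul_adjugate_eq (A * E)
    refine ⟨trace (A * E * X.adjugate), M' - B * M, ?_⟩
    have : A * (E * X.adjugate) = A * E * X.adjugate := (mul_assoc _ _ _).symm
    rw [hM', hM, mul_add, ← mul_assoc, hAB] at this
    rw [mul_sub, ← add_sub_assoc, ← this, mul_assoc]
    simp
  obtain ⟨cg, N₁, h₁⟩ := scal E₁
  obtain ⟨ch, N₂, h₂⟩ := scal E₂
  rw [hg] at h₁
  rw [hh] at h₂
  have hx : (h * cg - g * ch) • (1 : Matrix ι ι D) = X * (g • N₂ - h • N₁) := by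
    have e1 : h • (g • A) = g • (h • A) := smul_comm _ _ _
    rw [h₁, h₂] at e1
    simp only [smul_add, smul_smul] at e1
    rw [mul_sub, Matrix.mul_smul, Matrix.mul_smul, sub_smul, sub_eq_sub_iff_add_eq_add, e1]
    abel
  have hdx : X.det ∣ h * cg - g * ch := by
    refine hdg _ ⟨trace (E₁ * (g • N₂ - h • N₁)), ?_⟩
    have := congrArg (fun T => trace (E₁ * (X.adjugate * T))) hx
    simp only [← mul_assoc X.adjugate, adjugate_mul] at this
    simpa [mul_sub, hg, mul_left_comm] using this
  obtain ⟨e, he⟩ := hdx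
  obtain ⟨e₁, e₂, hee⟩ := Ideal.mem_span_pair.1 <| hghd e <| Ideal.mem_span_pair.2
    ⟨-ch, cg, by linear_combination he⟩
  obtain ⟨c, hc⟩ := hgh (cg - X.det * e₂)
    ⟨ch + X.det * e₁, by linear_combination he - X.det * hee⟩
  have hA : g • (A - c • 1) = X * (N₁ + e₂ • X.adjugate) := by
    rw [mul_add, Matrix.mul_smul, mul_adjugate, smul_sub, h₁, smul_smul, smul_smul, ← hc, sub_smul]
    rw [mul_comm e₂]
    abel
  have hdiv : ∀ i j, g ∣ (N₁ + e₂ • X.adjugate) i j := by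
    intro i j
    refine hgd _ ⟨(X.adjugate * (A - c • 1)) i j, ?_⟩
    have := congrArg (fun T => X.adjugate * T) hA
    simp only [← mul_assoc X.adjugate, adjugate_mul, Matrix.mul_smul, smul_mul, one_mul] at this
    rw [mul_comm]
    exact (congrFun₂ this i j).symm
  choose M hM using hdiv
  refine ⟨c, Matrix.of M, ?_⟩
  rw [← sub_eq_iff_eq_add']
  ext i j
  apply hg_reg.left
  have hN : N₁ + e₂ • X.adjugate = g • Matrix.of M := by ext i j; simpa using hM i j
  rw [hN, Matrix.mul_smul] at hA
  exact congrFun₂ hA i j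

end Matrix

section GenericMinors

variable {K : Type*} [CommRing K] {n k : ℕ}

/-- The lexicographic monomial order in which the variables of the generic matrix are ordered
column by column. -/
def columnLex (n : ℕ) : MonomialOrder (Fin n × Fin n) where
  syn := Lex ((Fin n ×ₗ Fin n) →₀ ℕ)
  toSyn := (Finsupp.domCongr ((Equiv.prodComm _ _).trans toLex)).trans
    { toEquiv := toLex, map_add' := toLex_add }
  toSyn_monotone := fun a b hab => Finsupp.toLex_monotone (α := Fin n ×ₗ Fin n)
    (a := Finsupp.domCongr ((Equiv.prodComm _ _).trans toLex) a)
    (b := Finsupp.domCongr ((Equiv.prodComm _ _).trans toLex) b) fun p => by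
      simpa using hab _

theorem columnLex_lt {a b : Fin n × Fin n →₀ ℕ} (p : Fin n × Fin n)
    (h : ∀ q : Fin n × Fin n, q.2 < p.2 ∨ q.2 = p.2 ∧ q.1 < p.1 → a q = b q) (hp : a p < b p) :
    (columnLex n).toSyn a < (columnLex n).toSyn b := by
  refine (Finsupp.Lex.lt_iff (α := Fin n ×ₗ Fin n) (N := ℕ)).2
    ⟨toLex p.swap, fun q hq => ?_, ?_⟩
  · exact h (ofLex q).swap (by simpa [Prod.Lex.lt_iff] using hq)
  · exact hp

/-- The exponent of the product of the variables at the positions `(r i, c i)`. -/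
def pathExponent (r c : Fin k → Fin n) : Fin n × Fin n →₀ ℕ :=
  ∑ i, Finsupp.single (r i, c i) 1

theorem pathExponent_apply {r c : Fin k → Fin n} (hc : Function.Injective c) (p : Fin n × Fin n)
    (i : Fin k) (hi : c i = p.2) : pathExponent r c p = if r i = p.1 then 1 else 0 := by
  rw [pathExponent, Finsupp.finsetSum_apply, Finset.sum_eq_single i]
  · simp [Finsupp.single_apply, Prod.ext_iff, hi]
  · intro j _ hj
    rw [Finsupp.single_eq_of_ne]
    rintro rfl
    exact hj (hc hi.symm)
  · simp

theorem pathExponent_eq_zero {r c : Fin k → Fin n} (p : Fin n × Fin n)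
    (h : ∀ i, (r i, c i) ≠ p) : pathExponent r c p = 0 := by
  rw [pathExponent, Finsupp.finsetSum_apply]
  exact Finset.sum_eq_zero fun i _ => Finsupp.single_eq_of_ne (h i).symm

theorem pathExponent_perm_lt {r c : Fin k → Fin n} (hr : StrictMono r) (hc : StrictMono c)
    {σ : Equiv.Perm (Fin k)} (hσ : σ ≠ 1) :
    (columnLex n).toSyn (pathExponent (r ∘ σ) c) < (columnLex n).toSyn (pathExponent r c) := by
  obtain ⟨i, hi, hmin⟩ : ∃ i, σ i ≠ i ∧ ∀ j < i, σ j = j := by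
    have hne : (Finset.univ.filter fun i => σ i ≠ i).Nonempty := by
      by_contra h0
      refine hσ (Equiv.ext fun i => ?_)
      by_contra hi
      exact h0 ⟨i, by simpa using hi⟩
    refine ⟨_, (Finset.mem_filter.1 (Finset.min'_mem _ hne)).2, fun j hj => ?_⟩
    by_contra h0
    exact absurd (Finset.min'_le _ j (by simpa using h0)) (not_le.2 hj)
  have hlt : i < σ i := by
    refine lt_of_le_of_ne (not_lt.1 fun h => ?_) hi.symm
    exact hi (σ.injective (hmin _ h))
  refine columnLex_lt (r i, c i) ?_ ?_
  · rintro ⟨a, b⟩ (hab | ⟨rfl, ha⟩)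
    · by_cases hb : ∃ j, c j = b
      · obtain ⟨j, rfl⟩ := hb
        rw [pathExponent_apply hc.injective _ j rfl, pathExponent_apply hc.injective _ j rfl,
          Function.comp, hmin j (hc.lt_iff_lt.1 hab)]
      · rw [pathExponent_eq_zero, pathExponent_eq_zero] <;>
          exact fun j hj => hb ⟨j, (Prod.ext_iff.1 hj).2⟩
    · rw [pathExponent_apply hc.injective _ i rfl, pathExponent_apply hc.injective _ i rfl,
        if_neg (show (r ∘ σ) i ≠ a from (lt_trans ha (hr hlt)).ne'),
        if_neg (show r i ≠ a from ha.ne')]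
  · rw [pathExponent_apply hc.injective _ i rfl, pathExponent_apply hc.injective _ i rfl,
      if_neg (show (r ∘ σ) i ≠ r i from (hr hlt).ne'), if_pos rfl]
    exact one_pos

theorem det_genericMatrix_submatrix (r c : Fin k → Fin n) :
    ((genericMatrix K n).submatrix r c).det =
      ∑ σ : Equiv.Perm (Fin k), MvPolynomial.monomial (pathExponent (r ∘ σ) c)
        ((Equiv.Perm.sign σ : ℤ) : K) := by
  rw [det_apply']
  refine Finset.sum_congr rfl fun σ _ => ?_
  rw [← mul_one ((Equiv.Perm.sign σ : ℤ) : K), ← MvPolynomial.C_mul_monomial, pathExponent,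
    MvPolynomial.monomial_sum_one]
  simp [genericMatrix, MvPolynomial.X]

theorem coeff_det_genericMatrix_submatrix {r c : Fin k → Fin n} (hr : StrictMono r)
    (hc : StrictMono c) :
    (((genericMatrix K n).submatrix r c).det).coeff (pathExponent r c) = 1 := by
  rw [det_genericMatrix_submatrix, MvPolynomial.coeff_sum, Finset.sum_eq_single 1]
  · simp
  · intro σ _ hσ
    rw [MvPolynomial.coeff_monomial, if_neg]
    intro h0
    exact (pathExponent_perm_lt hr hc hσ).ne (congrArg _ h0)
  · simp

variable [Nontrivial K]

theorem degree_det_genericMatrix_submatrix {r c : Fin k → Fin n} (hr : StrictMono r)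
    (hc : StrictMono c) :
    (columnLex n).degree (((genericMatrix K n).submatrix r c).det) = pathExponent r c := by
  apply (columnLex n).toSyn.injective
  apply le_antisymm
  · rw [det_genericMatrix_submatrix]
    refine MonomialOrder.degree_sum_le.trans (Finset.sup_le fun σ _ => ?_)
    refine ((columnLex n).degree_monomial_le _).trans ?_
    by_cases hσ : σ = 1
    · simp [hσ]
    · exact (pathExponent_perm_lt hr hc hσ).le
  · apply (columnLex n).le_degree
    rw [MvPolynomial.mem_support_iff, coeff_det_genericMatrix_submatrix hr hc]
    exact one_ne_zero

theorem monic_det_genericMatrix_submatrix {r c : Fin k → Fin n} (hr : StrictMono r)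
    (hc : StrictMono c) : (columnLex n).Monic (((genericMatrix K n).submatrix r c).det) := by
  rw [MonomialOrder.Monic, MonomialOrder.leadingCoeff, degree_det_genericMatrix_submatrix hr hc,
    coeff_det_genericMatrix_submatrix hr hc]

end GenericMinors

section GenericMatrix

variable {K : Type*} [CommRing K] {k l n : ℕ}

theorem pathExponent_eq_zero_or {r c : Fin k → Fin n} {r' c' : Fin l → Fin n}
    (h : ∀ i j, (r i, c i) ≠ (r' j, c' j)) (p : Fin n × Fin n) :
    pathExponent r c p = 0 ∨ pathExponent r' c' p = 0 := by
  by_cases hp : ∃ i, (r i, c i) = p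
  · obtain ⟨i, rfl⟩ := hp
    exact .inr (pathExponent_eq_zero _ fun j => (h i j).symm)
  · exact .inl (pathExponent_eq_zero _ fun i hi => hp ⟨i, hi⟩)

theorem Matrix.exists_trace_mul_adjugate_eq_det_submatrix {D : Type*} [CommRing D]
    (X : Matrix (Fin (k + 1)) (Fin (k + 1)) D) (i j : Fin (k + 1)) :
    ∃ E : Matrix (Fin (k + 1)) (Fin (k + 1)) D,
      trace (E * X.adjugate) = (X.submatrix i.succAbove j.succAbove).det := by
  refine ⟨Matrix.single i j ((-1) ^ (i + j : ℕ)), ?_⟩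
  rw [trace_single_mul, adjugate_fin_succ_eq_det_submatrix, smul_eq_mul, ← mul_assoc, ← mul_pow]
  simp

theorem Matrix.trace_mul_adjugate_mem_span {ι D : Type*} [Fintype ι] [DecidableEq ι] [CommRing D]
    (A X : Matrix ι ι D) : trace (A * X.adjugate) ∈
      Ideal.span (Set.range fun p : ι × ι => X.adjugate p.1 p.2) := by
  simp only [trace, diag_apply, mul_apply]
  exact sum_mem fun i _ => sum_mem fun j _ =>
    Ideal.mul_mem_left _ _ (Ideal.subset_span ⟨(j, i), rfl⟩)

theorem minorsIdeal_eq_span_adjugate : minorsIdeal K (k + 1) =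
    Ideal.span (Set.range fun p : Fin (k + 1) × Fin (k + 1) =>
      (genericMatrix K (k + 1)).adjugate p.1 p.2) := by
  have key : ∀ f : Fin k → Fin (k + 1), StrictMono f → ∃ p : Fin (k + 1), f = p.succAbove := by
    intro f hf
    have hcard : (Finset.univ.image f)ᶜ.card = 1 := by
      rw [Finset.card_compl, Finset.card_image_of_injective _ hf.injective]
      simp
    obtain ⟨p, hp⟩ := Finset.card_eq_one.1 hcard
    refine ⟨p, (hf.range_inj p.strictMono_succAbove).1 ?_⟩
    rw [Fin.range_succAbove, ← Finset.coe_singleton, ← hp]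
    simp
  apply le_antisymm
  · refine Ideal.span_le.2 ?_
    rintro _ ⟨f, g, hf, hg, rfl⟩
    obtain ⟨p, rfl⟩ := key f hf
    obtain ⟨q, rfl⟩ := key g hg
    obtain ⟨E, hE⟩ := (genericMatrix K (k + 1)).exists_trace_mul_adjugate_eq_det_submatrix p q
    rw [← hE]
    exact trace_mul_adjugate_mem_span _ _
  · refine Ideal.span_le.2 ?_
    rintro _ ⟨⟨i, j⟩, rfl⟩
    dsimp only
    rw [adjugate_fin_succ_eq_det_submatrix]
    exact Ideal.mul_mem_left _ _
      (Ideal.subset_span ⟨_, _, j.strictMono_succAbove, i.strictMono_succAbove, rfl⟩)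

variable [Nontrivial K]

theorem degree_det_genericMatrix :
    (columnLex n).degree (genericMatrix K n).det = pathExponent id id := by
  simpa using degree_det_genericMatrix_submatrix (K := K) (strictMono_id (α := Fin n)) strictMono_id

theorem monic_det_genericMatrix : (columnLex n).Monic (genericMatrix K n).det := by
  simpa using monic_det_genericMatrix_submatrix (K := K) (strictMono_id (α := Fin n)) strictMono_id

theorem exists_eq_smul_one_add_genericMatrix_mul
    {A B : Matrix (Fin (k + 1)) (Fin (k + 1)) (MvPolynomial (Fin (k + 1) × Fin (k + 1)) K)}
    (hAB : A * genericMatrix K (k + 1) = genericMatrix K (k + 1) * B) :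
    ∃ (c : MvPolynomial (Fin (k + 1) × Fin (k + 1)) K)
      (M : Matrix (Fin (k + 1)) (Fin (k + 1)) (MvPolynomial (Fin (k + 1) × Fin (k + 1)) K)),
      A = c • 1 + genericMatrix K (k + 1) * M := by
  obtain ⟨E₁, h₁⟩ := (genericMatrix K (k + 1)).exists_trace_mul_adjugate_eq_det_submatrix
    (Fin.last k) 0
  obtain ⟨E₂, h₂⟩ := (genericMatrix K (k + 1)).exists_trace_mul_adjugate_eq_det_submatrix
    0 (Fin.last k)
  rw [Fin.succAbove_last, Fin.succAbove_zero] at h₁ h₂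
  have mono₁ := Fin.strictMono_castSucc (n := k)
  have mono₂ := Fin.strictMono_succ (n := k)
  have hg := monic_det_genericMatrix_submatrix (K := K) mono₁ mono₂
  have hh := monic_det_genericMatrix_submatrix (K := K) mono₂ mono₁
  have hd := monic_det_genericMatrix (K := K) (n := k + 1)
  have gd : ∀ p, (columnLex (k + 1)).degree (((genericMatrix K (k + 1)).submatrix
      Fin.castSucc Fin.succ).det) p = 0 ∨ (columnLex (k + 1)).degree
      (genericMatrix K (k + 1)).det p = 0 := by
    rw [degree_det_genericMatrix_submatrix mono₁ mono₂, degree_det_genericMatrix]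
    refine pathExponent_eq_zero_or fun i j => ?_
    simp only [ne_eq, Prod.ext_iff, Fin.ext_iff, id, Fin.val_castSucc, Fin.val_succ]
    omega
  have hhd : ∀ p, (columnLex (k + 1)).degree (((genericMatrix K (k + 1)).submatrix
      Fin.succ Fin.castSucc).det) p = 0 ∨ (columnLex (k + 1)).degree
      (genericMatrix K (k + 1)).det p = 0 := by
    rw [degree_det_genericMatrix_submatrix mono₂ mono₁, degree_det_genericMatrix]
    refine pathExponent_eq_zero_or fun i j => ?_
    simp only [ne_eq, Prod.ext_iff, Fin.ext_iff, id, Fin.val_castSucc, Fin.val_succ]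
    omega
  have gh : ∀ p, (columnLex (k + 1)).degree (((genericMatrix K (k + 1)).submatrix
      Fin.castSucc Fin.succ).det) p = 0 ∨ (columnLex (k + 1)).degree
      (((genericMatrix K (k + 1)).submatrix Fin.succ Fin.castSucc).det) p = 0 := by
    rw [degree_det_genericMatrix_submatrix mono₁ mono₂,
      degree_det_genericMatrix_submatrix mono₂ mono₁]
    refine pathExponent_eq_zero_or fun i j => ?_
    simp only [ne_eq, Prod.ext_iff, Fin.ext_iff, Fin.val_castSucc, Fin.val_succ]
    omega
  exact exists_eq_smul_one_add_mul hAB h₁ h₂ hg.isRegular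
    (fun x => hd.dvd_of_dvd_mul hg fun p => (gd p).symm) (fun x => hg.dvd_of_dvd_mul hd gd)
    (fun x => hg.dvd_of_dvd_mul hh gh)
    (fun x => hg.mem_span_pair_of_mul_mem hh hd gh gd hhd)

/-- A scalar which factors through the cokernel of `X` lies in the ideal spanned by `det X`. -/
theorem det_genericMatrix_dvd_of_smul_one_eq {s : MvPolynomial (Fin (k + 1) × Fin (k + 1)) K}
    {M : Matrix (Fin (k + 1)) (Fin (k + 1)) (MvPolynomial (Fin (k + 1) × Fin (k + 1)) K)}
    (h : s • 1 = genericMatrix K (k + 1) * M) : (genericMatrix K (k + 1)).det ∣ s := by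
  obtain ⟨E, hE⟩ := (genericMatrix K (k + 1)).exists_trace_mul_adjugate_eq_det_submatrix
    (Fin.last k) 0
  rw [Fin.succAbove_last, Fin.succAbove_zero] at hE
  have mono₁ := Fin.strictMono_castSucc (n := k)
  have mono₂ := Fin.strictMono_succ (n := k)
  refine monic_det_genericMatrix.dvd_of_dvd_mul
    (monic_det_genericMatrix_submatrix mono₁ mono₂) ?_ ⟨trace (E * M), ?_⟩
  · rw [degree_det_genericMatrix_submatrix mono₁ mono₂, degree_det_genericMatrix]
    refine pathExponent_eq_zero_or fun i j => ?_
    simp only [ne_eq, Prod.ext_iff, Fin.ext_iff, id, Fin.val_castSucc, Fin.val_succ]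
    omega
  · have := congrArg (fun T => trace (E * ((genericMatrix K (k + 1)).adjugate * T))) h
    simp only [← mul_assoc _ (genericMatrix K (k + 1)), adjugate_mul] at this
    simpa [hE] using this

theorem mem_minorsIdeal_iff {s : MvPolynomial (Fin (k + 1) × Fin (k + 1)) K} :
    s ∈ minorsIdeal K (k + 1) ↔ ∃ A M, s • 1 =
      A * (genericMatrix K (k + 1)).adjugate + genericMatrix K (k + 1) * M := by
  rw [minorsIdeal_eq_span_adjugate]
  constructor
  · intro hs
    induction hs using Submodule.span_induction with
    | mem x hx =>
      obtain ⟨⟨i, j⟩, rfl⟩ := hx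
      obtain ⟨M, hM⟩ := (genericMatrix K (k + 1)).exists_mul_adjugate_eq (Matrix.single j i 1)
      refine ⟨Matrix.single j i 1, -M, ?_⟩
      rw [hM, trace_single_mul]
      simp
    | zero => exact ⟨0, 0, by simp⟩
    | add x y _ _ hx hy =>
      obtain ⟨A, M, h⟩ := hx
      obtain ⟨B, N, h'⟩ := hy
      exact ⟨A + B, M + N, by rw [add_smul, h, h', add_mul, mul_add]; abel⟩
    | smul a x _ hx =>
      obtain ⟨A, M, h⟩ := hx
      exact ⟨a • A, a • M, by rw [smul_assoc, h]; simp⟩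
  · rintro ⟨A, M, h⟩
    obtain ⟨N, hN⟩ := (genericMatrix K (k + 1)).exists_mul_adjugate_eq A
    set t := trace (A * (genericMatrix K (k + 1)).adjugate)
    have hdvd : (genericMatrix K (k + 1)).det ∣ s - t := by
      refine det_genericMatrix_dvd_of_smul_one_eq (M := N + M) ?_
      rw [sub_smul, h, hN, mul_add]
      abel
    have hdet : (genericMatrix K (k + 1)).det ∈
        Ideal.span (Set.range fun p : Fin (k + 1) × Fin (k + 1) =>
          (genericMatrix K (k + 1)).adjugate p.1 p.2) := by
      rw [det_eq_sum_mul_adjugate_row _ 0]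
      exact sum_mem fun j _ => Ideal.mul_mem_left _ _ (Ideal.subset_span ⟨(j, 0), rfl⟩)
    rw [← sub_add_cancel s t]
    exact add_mem (Ideal.mem_of_dvd _ hdvd hdet) (trace_mul_adjugate_mem_span _ _)

end GenericMatrix

section Hypersurface

variable {ι D : Type*} [CommRing D] {d : D}

theorem Matrix.exists_map_quotientMk_eq (I : Ideal D) (A : Matrix ι ι (D ⧸ I)) :
    ∃ B : Matrix ι ι D, B.map (Ideal.Quotient.mk I) = A := by
  choose B hB using fun i j => Ideal.Quotient.mk_surjective (A i j)
  exact ⟨Matrix.of B, by ext i j; simp [hB]⟩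

theorem Matrix.exists_eq_smul_of_map_quotientMk_eq_zero {A : Matrix ι ι D}
    (h : A.map (Ideal.Quotient.mk (Ideal.span {d})) = 0) : ∃ B : Matrix ι ι D, A = d • B := by
  have : ∀ i j, d ∣ A i j := fun i j => by
    rw [← Ideal.mem_span_singleton, ← Ideal.Quotient.eq_zero_iff_mem]
    exact congrFun₂ h i j
  choose B hB using this
  exact ⟨Matrix.of B, by ext i j; simp [hB]⟩

variable [Fintype ι] [DecidableEq ι]

/-- A matrix factorization of a regular element `d` gives an exact pair of matrices modulo `d`. -/
theorem Matrix.range_mulVecLin_map_eq_ker {X Y : Matrix ι ι D} (hXY : X * Y = d • 1)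
    (hYX : Y * X = d • 1) (hd : IsRegular d) :
    LinearMap.range (X.map (Ideal.Quotient.mk (Ideal.span {d}))).mulVecLin =
      LinearMap.ker (Y.map (Ideal.Quotient.mk (Ideal.span {d}))).mulVecLin := by
  have hd0 : Ideal.Quotient.mk (Ideal.span {d}) d = 0 :=
    Ideal.Quotient.eq_zero_iff_mem.2 (Ideal.mem_span_singleton_self d)
  apply le_antisymm
  · rintro _ ⟨v, rfl⟩
    rw [LinearMap.mem_ker, mulVecLin_apply, mulVecLin_apply, mulVec_mulVec, ← Matrix.map_mul, hYX]
    ext i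
    simp [mulVec, dotProduct, hd0]
  · intro v hv
    choose w hw using fun i => Ideal.Quotient.mk_surjective (v i)
    obtain rfl : Ideal.Quotient.mk (Ideal.span {d}) ∘ w = v := funext hw
    have : ∀ i, d ∣ (Y *ᵥ w) i := fun i => by
      rw [← Ideal.mem_span_singleton, ← Ideal.Quotient.eq_zero_iff_mem, RingHom.map_mulVec]
      exact congrFun hv i
    choose u hu using this
    refine ⟨Ideal.Quotient.mk _ ∘ u, funext fun i => ?_⟩
    rw [mulVecLin_apply, ← RingHom.map_mulVec]
    have h := congrArg (X *ᵥ ·) (show Y *ᵥ w = d • u from funext hu)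
    simp only [mulVec_mulVec, hXY, smul_mulVec, one_mulVec, mulVec_smul] at h
    exact congrArg _ (hd.left (congrFun h i)).symm

theorem Matrix.exists_mkQ_comp_mulVecLin_eq {I : Ideal D} (N : Submodule (D ⧸ I) (ι → D ⧸ I))
    (ω : (ι → D ⧸ I) →ₗ[D ⧸ I] (ι → D ⧸ I) ⧸ N) :
    ∃ A : Matrix ι ι D, ω = N.mkQ ∘ₗ (A.map (Ideal.Quotient.mk I)).mulVecLin := by
  choose a ha using fun j => N.mkQ_surjective (ω (Pi.single j 1))
  obtain ⟨A, hA⟩ := Matrix.exists_map_quotientMk_eq I (Matrix.of a)ᵀ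
  refine ⟨A, LinearMap.pi_ext' fun j => LinearMap.ext_ring ?_⟩
  simp only [LinearMap.comp_apply, LinearMap.coe_single, hA, ← ha, mulVecLin_apply,
    mulVec_single_one]
  rfl

/-- A matrix acts as zero on the cokernel of `X` if and only if it factors through `X`. -/
theorem Matrix.mkQ_comp_mulVecLin_eq_zero_iff {X Y A : Matrix ι ι D} (hXY : X * Y = d • 1) :
    (LinearMap.range (X.map (Ideal.Quotient.mk (Ideal.span {d}))).mulVecLin).mkQ ∘ₗ
      (A.map (Ideal.Quotient.mk (Ideal.span {d}))).mulVecLin = 0 ↔ ∃ M, A = X * M := by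
  constructor
  · intro h
    have : ∀ j, ∃ v, (X.map (Ideal.Quotient.mk (Ideal.span {d}))).mulVecLin v =
        (A.map (Ideal.Quotient.mk (Ideal.span {d}))).col j := fun j => by
      have := LinearMap.congr_fun h (Pi.single j 1)
      rwa [LinearMap.comp_apply, mulVecLin_apply, mulVec_single_one, LinearMap.zero_apply,
        Submodule.mkQ_apply, Submodule.Quotient.mk_eq_zero] at this
    choose v hv using this
    obtain ⟨M, hM⟩ := Matrix.exists_map_quotientMk_eq _ (Matrix.of v)ᵀ
    obtain ⟨C, hC⟩ := Matrix.exists_eq_smul_of_map_quotientMk_eq_zero (d := d) (A := A - X * M) (by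
      rw [Matrix.map_sub _ (map_sub _), Matrix.map_mul, hM, sub_eq_zero]
      ext i j
      exact (congrFun (hv j) i).symm)
    refine ⟨M + Y * C, ?_⟩
    rw [mul_add, ← mul_assoc, hXY, smul_mul, one_mul, ← hC, add_sub_cancel]
  · rintro ⟨M, rfl⟩
    rw [Matrix.map_mul, mulVecLin_mul, ← LinearMap.comp_assoc, LinearMap.range_mkQ_comp,
      LinearMap.zero_comp]

theorem Matrix.mkQ_comp_mulVecLin_eq_iff {X Y A B : Matrix ι ι D} (hXY : X * Y = d • 1) :
    (LinearMap.range (X.map (Ideal.Quotient.mk (Ideal.span {d}))).mulVecLin).mkQ ∘ₗ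
      (A.map (Ideal.Quotient.mk (Ideal.span {d}))).mulVecLin =
    (LinearMap.range (X.map (Ideal.Quotient.mk (Ideal.span {d}))).mulVecLin).mkQ ∘ₗ
      (B.map (Ideal.Quotient.mk (Ideal.span {d}))).mulVecLin ↔ ∃ M, A = B + X * M := by
  have hsub : ((A - B).map (Ideal.Quotient.mk (Ideal.span {d}))).mulVecLin =
      (A.map (Ideal.Quotient.mk (Ideal.span {d}))).mulVecLin -
        (B.map (Ideal.Quotient.mk (Ideal.span {d}))).mulVecLin := by
    refine LinearMap.ext fun v => ?_
    rw [Matrix.map_sub _ (map_sub _)]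
    exact sub_mulVec _ _ _
  rw [← sub_eq_zero, ← LinearMap.comp_sub, ← hsub, Matrix.mkQ_comp_mulVecLin_eq_zero_iff hXY]
  exact exists_congr fun M => sub_eq_iff_eq_add'

end Hypersurface

/-- A module which is cyclic over a quotient of `S`, as a quotient of `S`. -/
theorem exists_addEquiv_quotient_of_cyclic {S R Q : Type*} [CommRing S] [CommRing R]
    [AddCommGroup Q] [Module R Q] (p : S →+* R) (I : Ideal S) (q : Q)
    (hq : ∀ x, ∃ s, p s • q = x) (hI : ∀ s, p s • q = 0 ↔ s ∈ I) :
    ∃ e : Q ≃+ S ⧸ I, ∀ s x, e (p s • x) = Ideal.Quotient.mk I s * e x := by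
  let := Module.compHom Q p
  have hker : I = LinearMap.ker (LinearMap.toSpanSingleton S Q q) :=
    Submodule.ext fun s => (hI s).symm
  let e := (Submodule.quotEquivOfEq _ _ hker).trans
    ((LinearMap.toSpanSingleton S Q q).quotKerEquivOfSurjective hq)
  exact ⟨e.symm.toAddEquiv, fun s x => e.symm.map_smul s x⟩

section Periodic

universe u

theorem ShortComplex.exists_linearMap_homology {R : Type*} [Ring R]
    (S : ShortComplex (ModuleCat R)) :
    ∃ p : LinearMap.ker S.g.hom →ₗ[R] S.homology,
      Function.Surjective p ∧ ∀ z, p z = 0 ↔ ∃ y, S.f.hom y = z := by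
  obtain ⟨e⟩ : Nonempty ((LinearMap.ker S.g.hom ⧸ LinearMap.range S.moduleCatToCycles) ≃ₗ[R]
    S.homology) := ⟨S.moduleCatHomologyIso.symm.toLinearEquiv⟩
  refine ⟨e.toLinearMap ∘ₗ (LinearMap.range S.moduleCatToCycles).mkQ,
    e.surjective.comp (Submodule.mkQ_surjective _), fun z => ?_⟩
  rw [LinearMap.comp_apply, LinearEquiv.coe_coe, LinearEquiv.map_eq_zero_iff, Submodule.mkQ_apply,
    Submodule.Quotient.mk_eq_zero]
  exact exists_congr fun y => Subtype.ext_iff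

theorem HomologicalComplex.exists_linearMap_homology {R : Type*} [Ring R] {ι : Type*}
    {c : ComplexShape ι} (C : HomologicalComplex (ModuleCat R) c) {i j k : ι} (hi : c.prev j = i)
    (hk : c.next j = k) {f : C.X i ⟶ C.X j} {g : C.X j ⟶ C.X k} (hf : C.d i j = f)
    (hg : C.d j k = g) :
    ∃ p : LinearMap.ker g.hom →ₗ[R] C.homology j,
      Function.Surjective p ∧ ∀ z, p z = 0 ↔ ∃ y, f.hom y = z := by
  subst hf hg
  obtain ⟨p, hp, hp0⟩ := ShortComplex.exists_linearMap_homology (C.sc' i j k)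
  obtain ⟨e⟩ : Nonempty ((C.sc' i j k).homology ≃ₗ[R] C.homology j) :=
    ⟨(ShortComplex.homologyMapIso (C.isoSc' i j k hi hk)).symm.toLinearEquiv⟩
  exact ⟨e.toLinearMap ∘ₗ p, e.surjective.comp hp, fun z =>
    (LinearEquiv.map_eq_zero_iff e).trans (hp0 z)⟩

variable {R F : Type u} [CommRing R] [AddCommGroup F] [Module R F] {φ ψ : F →ₗ[R] F}

/-- The 2-periodic complex with terms `F` and differentials `…, φ, ψ, φ, ψ`. -/
def periodicComplex (hφ : LinearMap.range φ = LinearMap.ker ψ)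
    (hψ : LinearMap.range ψ = LinearMap.ker φ) : ChainComplex (ModuleCat.{u} R) ℕ :=
  HomologicalComplex.alternatingConst (ModuleCat.of R F) (φ := ModuleCat.ofHom φ)
    (ψ := ModuleCat.ofHom ψ)
    (ModuleCat.hom_ext (LinearMap.range_le_ker_iff.1 hφ.le))
    (ModuleCat.hom_ext (LinearMap.range_le_ker_iff.1 hψ.le))
    fun _ _ => ComplexShape.down_nat_odd_add

variable (hφ : LinearMap.range φ = LinearMap.ker ψ) (hψ : LinearMap.range ψ = LinearMap.ker φ)

theorem periodicComplex_d_even {n : ℕ} (hn : Even n) :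
    (periodicComplex hφ hψ).d (n + 1) n = ModuleCat.ofHom ψ := by
  have : ¬ Even (n + 1) := Nat.not_even_iff_odd.2 hn.add_one
  simp [periodicComplex, HomologicalComplex.alternatingConst, this]

theorem periodicComplex_d_odd {n : ℕ} (hn : Odd n) :
    (periodicComplex hφ hψ).d (n + 1) n = ModuleCat.ofHom φ := by
  have : Even (n + 1) := hn.add_one
  simp [periodicComplex, HomologicalComplex.alternatingConst, this]

/-- The augmentation of the periodic complex to the cokernel of its last map. -/
def periodicComplexAugmentation : periodicComplex hφ hψ ⟶
    (ChainComplex.single₀ (ModuleCat.{u} R)).obj (ModuleCat.of R (F ⧸ LinearMap.range ψ)) :=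
  ((periodicComplex hφ hψ).toSingle₀Equiv _).symm
    ⟨ModuleCat.ofHom (LinearMap.range ψ).mkQ, by
      rw [periodicComplex_d_even hφ hψ (by simp : Even 0)]
      exact ModuleCat.hom_ext (LinearMap.range_mkQ_comp ψ)⟩

theorem periodicComplexAugmentation_f_zero : (periodicComplexAugmentation hφ hψ).f 0 =
    ModuleCat.ofHom (LinearMap.range ψ).mkQ := by
  exact ChainComplex.toSingle₀Equiv_symm_apply_f_zero _ _

theorem quasiIso_periodicComplexAugmentation : QuasiIso (periodicComplexAugmentation hφ hψ) where
  quasiIsoAt m := by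
    induction m with
    | zero =>
      rw [ChainComplex.quasiIsoAt₀_iff, ShortComplex.quasiIso_iff_of_zeros' _ rfl rfl rfl]
      constructor
      · rw [ShortComplex.moduleCat_exact_iff_range_eq_ker]
        change LinearMap.range ((periodicComplex hφ hψ).d 1 0).hom =
          LinearMap.ker ((periodicComplexAugmentation hφ hψ).f 0).hom
        rw [periodicComplex_d_even hφ hψ (by simp : Even 0), periodicComplexAugmentation_f_zero]
        exact (Submodule.ker_mkQ _).symm
      · rw [ModuleCat.epi_iff_surjective]
        change Function.Surjective ((periodicComplexAugmentation hφ hψ).f 0)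
        rw [periodicComplexAugmentation_f_zero]
        exact Submodule.mkQ_surjective _
    | succ m _ =>
      rw [quasiIsoAt_iff_exactAt' (hL := ChainComplex.exactAt_succ_single_obj ..),
        HomologicalComplex.exactAt_iff' _ (m + 2) (m + 1) m (by simp) (by simp),
        ShortComplex.moduleCat_exact_iff_range_eq_ker]
      change LinearMap.range ((periodicComplex hφ hψ).d (m + 1 + 1) (m + 1)).hom =
        LinearMap.ker ((periodicComplex hφ hψ).d (m + 1) m).hom
      rcases Nat.even_or_odd m with hm | hm
      · rw [periodicComplex_d_even _ _ hm, periodicComplex_d_odd _ _ hm.add_one]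
        exact hφ
      · rw [periodicComplex_d_odd _ _ hm, periodicComplex_d_even _ _ hm.add_one]
        exact hψ

/-- The 2-periodic complex as a projective resolution of the cokernel of its last map. -/
def periodicResolution [Module.Projective R F] :
    ProjectiveResolution (ModuleCat.of R (F ⧸ LinearMap.range ψ)) where
  complex := periodicComplex hφ hψ
  projective _ := (IsProjective.iff_projective (R := R) F).1 inferInstance
  π := periodicComplexAugmentation hφ hψ
  quasiIso := quasiIso_periodicComplexAugmentation hφ hψ

theorem exists_linearMap_ext_two [Module.Projective R F]
    (hφ : LinearMap.range φ = LinearMap.ker ψ) (hψ : LinearMap.range ψ = LinearMap.ker φ)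
    (N : Type u) [AddCommGroup N] [Module R N] :
    ∃ p : LinearMap.ker (ψ.lcomp R N) →ₗ[R] ((Ext R (ModuleCat.{u} R) 2).obj
        (Opposite.op (ModuleCat.of R (F ⧸ LinearMap.range ψ)))).obj (ModuleCat.of R N),
      Function.Surjective p ∧ ∀ z, p z = 0 ↔ ∃ y : F →ₗ[R] N, y ∘ₗ φ = z := by
  obtain ⟨e⟩ : Nonempty (((periodicResolution hφ hψ).complex.linearYonedaObj R
      (ModuleCat.of R N)).homology 2 ≃ₗ[R] ((Ext R (ModuleCat.{u} R) 2).obj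
        (Opposite.op (ModuleCat.of R (F ⧸ LinearMap.range ψ)))).obj (ModuleCat.of R N)) :=
    ⟨((periodicResolution hφ hψ).isoExt (R := R) 2 (ModuleCat.of R N)).symm.toLinearEquiv⟩
  obtain ⟨p, hp, hp0⟩ := HomologicalComplex.exists_linearMap_homology
    ((periodicResolution hφ hψ).complex.linearYonedaObj R (ModuleCat.of R N))
    (i := 1) (j := 2) (k := 3) (by simp) (by simp)
    (f := ModuleCat.ofHom (Linear.leftComp R (ModuleCat.of R N) (ModuleCat.ofHom φ)))
    (g := ModuleCat.ofHom (Linear.leftComp R (ModuleCat.of R N) (ModuleCat.ofHom ψ)))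
    ((ChainComplex.linearYonedaObj_d ..).trans (congrArg
      (fun d => ModuleCat.ofHom (Linear.leftComp R (ModuleCat.of R N) d))
      (periodicComplex_d_odd hφ hψ (n := 1) (by simp))))
    ((ChainComplex.linearYonedaObj_d ..).trans (congrArg
      (fun d => ModuleCat.ofHom (Linear.leftComp R (ModuleCat.of R N) d))
      (periodicComplex_d_even hφ hψ (n := 2) (by simp))))
  let h : (F →ₗ[R] N) ≃ₗ[R] (ModuleCat.of R F ⟶ ModuleCat.of R N) :=
    (ModuleCat.homLinearEquiv (S := R) (M := ModuleCat.of R F) (N := ModuleCat.of R N)).symm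
  refine ⟨e.toLinearMap ∘ₗ p ∘ₗ (h.toLinearMap.restrict fun y hy => ModuleCat.hom_ext hy), ?_, ?_⟩
  · refine e.surjective.comp (hp.comp ?_)
    rintro ⟨z, hz⟩
    exact ⟨⟨ModuleCat.Hom.hom z, congrArg ModuleCat.Hom.hom hz⟩, rfl⟩
  · intro z
    refine ((LinearEquiv.map_eq_zero_iff e).trans (hp0 _)).trans ⟨?_, ?_⟩
    · rintro ⟨y, hy⟩
      exact ⟨ModuleCat.Hom.hom y, congrArg ModuleCat.Hom.hom hy⟩
    · rintro ⟨y, hy⟩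
      exact ⟨ModuleCat.ofHom y, ModuleCat.hom_ext hy⟩

end Periodic

section MatrixFactorization

universe u

variable {ι : Type} [Fintype ι] [DecidableEq ι] {D : Type u} [CommRing D] {d : D}

theorem Matrix.mulVecLin_map_smul_one (s : D) :
    ((s • 1 : Matrix ι ι D).map (Ideal.Quotient.mk (Ideal.span {d}))).mulVecLin =
      Ideal.Quotient.mk (Ideal.span {d}) s • LinearMap.id := by
  refine LinearMap.ext fun v => funext fun i => ?_
  simp [mulVec, dotProduct, one_apply, apply_ite (Ideal.Quotient.mk (Ideal.span {d}))]

set_option maxHeartbeats 400000 in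
/-- `Ext²` of the cokernel `L` of a matrix factorization `(X, Y)` of a regular element, when all
the endomorphisms of `L` are scalars. -/
theorem exists_ext_two_addEquiv {X Y : Matrix ι ι D} (hXY : X * Y = d • 1) (hYX : Y * X = d • 1)
    (hd : IsRegular d)
    (hX : ∀ A B : Matrix ι ι D, A * X = X * B → ∃ (c : D) (M : Matrix ι ι D), A = c • 1 + X * M)
    (I : Ideal D) (hI : ∀ s, s ∈ I ↔ ∃ A M : Matrix ι ι D, s • 1 = A * Y + X * M) :
    letI R := D ⧸ Ideal.span {d}
    letI L := (ι → R) ⧸ LinearMap.range (X.map (Ideal.Quotient.mk (Ideal.span {d}))).mulVecLin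
    letI E := ((Ext R (ModuleCat.{u} R) 2).obj
        (Opposite.op (ModuleCat.of R L))).obj (ModuleCat.of R L)
    ∃ e : E ≃+ D ⧸ I, ∀ (s : D) (x : E),
      e (Ideal.Quotient.mk (Ideal.span {d}) s • x) = Ideal.Quotient.mk I s * e x := by
  obtain ⟨p, hp, hp0⟩ := exists_linearMap_ext_two
    (Matrix.range_mulVecLin_map_eq_ker hYX hXY hd) (Matrix.range_mulVecLin_map_eq_ker hXY hYX hd)
    ((ι → D ⧸ Ideal.span {d}) ⧸
      LinearMap.range (X.map (Ideal.Quotient.mk (Ideal.span {d}))).mulVecLin)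
  have hmat (A B : Matrix ι ι D) := Matrix.mkQ_comp_mulVecLin_eq_iff (A := A) (B := B) hXY
  set π := (LinearMap.range (X.map (Ideal.Quotient.mk (Ideal.span {d}))).mulVecLin).mkQ
  have hsmul (s : D) : Ideal.Quotient.mk (Ideal.span {d}) s • π =
      π ∘ₗ ((s • 1 : Matrix ι ι D).map (Ideal.Quotient.mk (Ideal.span {d}))).mulVecLin := by
    rw [Matrix.mulVecLin_map_smul_one, LinearMap.comp_smul, LinearMap.comp_id]
  refine exists_addEquiv_quotient_of_cyclic _ I (p ⟨π, LinearMap.range_mkQ_comp _⟩)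
    (fun x => ?_) fun s => ?_
  · obtain ⟨⟨ω, hω⟩, rfl⟩ := hp x
    obtain ⟨A, rfl⟩ := Matrix.exists_mkQ_comp_mulVecLin_eq _ ω
    obtain ⟨B, hB⟩ := (Matrix.mkQ_comp_mulVecLin_eq_zero_iff (A := A * X) hXY).1 (by
      rw [Matrix.map_mul, mulVecLin_mul]
      exact hω)
    obtain ⟨c, M, hA⟩ := hX A B hB
    refine ⟨c, ?_⟩
    rw [← map_smul]
    refine congrArg p (Subtype.ext ((hsmul c).trans ?_))
    exact ((hmat _ _).2 ⟨M, hA⟩).symm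
  · rw [← map_smul, hp0]
    refine Iff.trans ⟨?_, ?_⟩ (hI s).symm
    · rintro ⟨ω, hω⟩
      obtain ⟨A, rfl⟩ := Matrix.exists_mkQ_comp_mulVecLin_eq _ ω
      rw [LinearMap.comp_assoc, ← mulVecLin_mul, ← Matrix.map_mul] at hω
      obtain ⟨M, hM⟩ := (hmat _ _).1 ((hsmul s).symm.trans hω.symm)
      exact ⟨A, M, hM⟩
    · rintro ⟨A, M, h⟩
      refine ⟨π ∘ₗ (A.map (Ideal.Quotient.mk (Ideal.span {d}))).mulVecLin, ?_⟩
      rw [LinearMap.comp_assoc, ← mulVecLin_mul, ← Matrix.map_mul]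
      exact (((hmat _ _).2 ⟨M, h⟩).symm).trans (hsmul s).symm

end MatrixFactorization

set_option synthInstance.maxHeartbeats 1000000 in
set_option maxHeartbeats 1000000 in
/-- Let `K` be a commutative Noetherian normal domain, `n ≥ 2`, `X` the
generic `n × n` matrix over `K`, `R = S/(det X)`, and `L = coker(X̄ : Rⁿ → Rⁿ)`.  Then
`Ext²_R(L, L)` is isomorphic, as an `R`-module, to `S/I_{n-1}(X)`: there is an additive
isomorphism `e` compatible with the scalar actions of `S` on both sides (the `R = S/(det X)`
action on `Ext²` and the `S/I_{n-1}(X)` action on itself, `det X` lying in `I_{n-1}(X)`). -/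
theorem statement15 (K : Type*) [CommRing K] [IsDomain K] [IsNoetherianRing K]
    [IsIntegrallyClosed K] (n : ℕ) (hn : 2 ≤ n) :
    letI R := genericDetRing K n
    letI L := (Fin n → R) ⧸ LinearMap.range (Matrix.mulVecLin (genericMatrixBar K n))
    letI E := (((Ext R (ModuleCat R) 2).obj
        (Opposite.op (ModuleCat.of R L))).obj (ModuleCat.of R L))
    ∃ e : E ≃+ (MvPolynomial (Fin n × Fin n) K ⧸ minorsIdeal K n),
      ∀ (s : MvPolynomial (Fin n × Fin n) K) (x : E),
        e ((Ideal.Quotient.mk (Ideal.span {(genericMatrix K n).det}) s) • x)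
          = Ideal.Quotient.mk (minorsIdeal K n) s * e x := by
  obtain ⟨k, rfl⟩ : ∃ k, n = k + 1 := ⟨n - 1, by omega⟩
  exact exists_ext_two_addEquiv (mul_adjugate _) (adjugate_mul _)
    monic_det_genericMatrix.isRegular (fun _ _ => exists_eq_smul_one_add_genericMatrix_mul)
    (minorsIdeal K (k + 1)) fun _ => mem_minorsIdeal_iff

end
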